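/- arXiv:2402.18257 — 3 statements merged into one kernel-verified Lean document; each statement's English description precedes it below -/
import Mathlib

section
/- Let τ ∈ (0,1), ν > -1 and N ≥ 1 be an integer. Define 𝒦_N(z,w) := ∑_{j=0}^{N-1} (j!·τ^{2j}/Γ(j+ν+1))·L_j^{(ν)}(z/τ)·L_j^{(ν)}(w/τ) for z,w ∈ ℂ. Then for all z,w ∈ ℂ: (1-τ²)·z·∂_z²𝒦_N(z,w) + ((1-τ²)(ν+1) + 2τz)·∂_z𝒦_N(z,w) + ((τ²z - w)/(1-τ²) + (ν+1)τ)·𝒦_N(z,w) = (N!·τ^{2N-1}/(Γ(N+ν)·(1-τ²)))·[ L_{N-1}^{(ν)}(z/τ)·L_N^{(ν)}(w/τ) − τ²·L_N^{(ν)}(z/τ)·L_{N-1}^{(ν)}(w/τ) ]. -/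
open MeasureTheory

/-- Generalized Laguerre polynomial `L_j^{(ν)}(z)`. -/
noncomputable def laguerre (ν : ℝ) (j : ℕ) (z : ℂ) : ℂ :=
  ∑ k ∈ Finset.range (j + 1),
    ((Real.Gamma ((j : ℝ) + ν + 1) /
        (((j - k).factorial : ℝ) * Real.Gamma (ν + (k : ℝ) + 1)) : ℝ) : ℂ) *
      (-z) ^ k / ((k.factorial : ℝ) : ℂ)

/-- The kernel `𝒦_N(z,w) = ∑_{j<N} (j! τ^{2j}/Γ(j+ν+1)) L_j^{(ν)}(z/τ) L_j^{(ν)}(w/τ)`. -/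
noncomputable def mathcalK (τ ν : ℝ) (N : ℕ) (z w : ℂ) : ℂ :=
  ∑ j ∈ Finset.range N,
    (((j.factorial : ℝ) * τ ^ (2 * j) / Real.Gamma ((j : ℝ) + ν + 1) : ℝ) : ℂ) *
      laguerre ν j (z / (τ : ℂ)) * laguerre ν j (w / (τ : ℂ))

open Polynomial in
/-- The generalized Laguerre polynomial, with real coefficients. -/
noncomputable def laguerrePoly (ν : ℝ) (j : ℕ) : ℝ[X] :=
  ∑ k ∈ Finset.range (j + 1),
    C (Real.Gamma ((j : ℝ) + ν + 1) / (((j - k).factorial : ℝ) * Real.Gamma (ν + (k : ℝ) + 1)) *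
      (-1) ^ k / (k.factorial : ℝ)) * X ^ k

/-- The reciprocal of `(j - k)!`, extended by zero to `j < k`. -/
noncomputable def invFactorialSub (j k : ℕ) : ℝ :=
  if k ≤ j then ((j - k).factorial : ℝ)⁻¹ else 0

theorem invFactorialSub_succ_succ (j k : ℕ) :
    invFactorialSub (j + 1) (k + 1) = invFactorialSub j k := by
  simp [invFactorialSub]

theorem invFactorialSub_succ_right (j k : ℕ) :
    invFactorialSub j (k + 1) = ((j : ℝ) - k) * invFactorialSub j k := by
  unfold invFactorialSub
  rcases lt_trichotomy k j with h | rfl | h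
  · obtain ⟨m, rfl⟩ := Nat.exists_eq_add_of_lt h
    have h1 : k + m + 1 - (k + 1) = m := by omega
    have h2 : k + m + 1 - k = m + 1 := by omega
    have h3 : k + 1 ≤ k + m + 1 := by omega
    have h4 : k ≤ k + m + 1 := by omega
    rw [if_pos h3, if_pos h4, h1, h2, Nat.factorial_succ]
    push_cast
    have : (m.factorial : ℝ) ≠ 0 := by positivity
    have : (m : ℝ) + 1 ≠ 0 := by positivity
    field_simp
    ring
  · simp
  · rw [if_neg (by omega), if_neg (by omega), mul_zero]

theorem invFactorialSub_eq_succ_left (j k : ℕ) :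
    invFactorialSub j k = ((j : ℝ) + 1 - k) * invFactorialSub (j + 1) k := by
  rw [← invFactorialSub_succ_succ, invFactorialSub_succ_right]
  push_cast
  rfl

theorem coeff_laguerrePoly (ν : ℝ) (j k : ℕ) :
    (laguerrePoly ν j).coeff k = Real.Gamma ((j : ℝ) + ν + 1) * invFactorialSub j k * (-1) ^ k /
      (Real.Gamma (ν + (k : ℝ) + 1) * (k.factorial : ℝ)) := by
  unfold laguerrePoly invFactorialSub
  simp only [Polynomial.finsetSum_coeff, Polynomial.coeff_C_mul_X_pow]
  rw [Finset.sum_ite_eq]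
  by_cases h : k ≤ j
  · rw [if_pos (by simpa [Nat.lt_succ_iff] using h), if_pos h]
    simp only [div_eq_mul_inv, mul_inv]
    ring
  · rw [if_neg (by simpa [Nat.lt_succ_iff] using h), if_neg h]
    simp

theorem laguerre_eq_aeval (ν : ℝ) (j : ℕ) (z : ℂ) :
    laguerre ν j z = Polynomial.aeval z (laguerrePoly ν j) := by
  unfold laguerre laguerrePoly
  rw [map_sum]
  refine Finset.sum_congr rfl fun k _ => ?_
  simp only [map_mul, map_pow, Polynomial.aeval_C, Polynomial.aeval_X, Complex.coe_algebraMap]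
  rw [neg_pow z]
  push_cast
  ring

theorem gamma_natCast_add_ne_zero {ν : ℝ} (hν : -1 < ν) (k : ℕ) :
    Real.Gamma (ν + (k : ℝ) + 1) ≠ 0 :=
  (Real.Gamma_pos_of_pos (by have : (0 : ℝ) ≤ k := k.cast_nonneg; linarith)).ne'

theorem gamma_natCast_succ_add {ν : ℝ} (hν : -1 < ν) (k : ℕ) :
    Real.Gamma (ν + ((k + 1 : ℕ) : ℝ) + 1) = (ν + k + 1) * Real.Gamma (ν + (k : ℝ) + 1) := by
  rw [← Real.Gamma_add_one (by have : (0 : ℝ) ≤ k := k.cast_nonneg; linarith)]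
  push_cast
  ring_nf

open Polynomial in
theorem laguerrePoly_differential_eq {ν : ℝ} (hν : -1 < ν) (j : ℕ) :
    X * derivative (derivative (laguerrePoly ν j)) + C (ν + 1) * derivative (laguerrePoly ν j) =
      X * derivative (laguerrePoly ν j) - C (j : ℝ) * laguerrePoly ν j := by
  have key (k : ℕ) : ((k : ℝ) + 1) * (ν + k + 1) * (laguerrePoly ν j).coeff (k + 1) =
      ((k : ℝ) - j) * (laguerrePoly ν j).coeff k := by
    have h1 := gamma_natCast_add_ne_zero hν k
    have h2 : ν + k + 1 ≠ 0 := by have : (0 : ℝ) ≤ k := k.cast_nonneg; linarith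
    have h3 : (k.factorial : ℝ) ≠ 0 := by positivity
    have h4 : (k : ℝ) + 1 ≠ 0 := by positivity
    rw [coeff_laguerrePoly, coeff_laguerrePoly, gamma_natCast_succ_add hν,
      invFactorialSub_succ_right, Nat.factorial_succ]
    push_cast
    field_simp
    ring
  ext k
  rcases k with _ | k
  · have := key 0
    simp [coeff_derivative] at this ⊢
    linarith
  · have := key (k + 1)
    simp only [coeff_add, coeff_sub, coeff_X_mul, coeff_C_mul, coeff_derivative]
    push_cast at this ⊢
    linear_combination this

open Polynomial in
theorem X_mul_derivative_laguerrePoly_succ {ν : ℝ} (hν : -1 < ν) (j : ℕ) :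
    X * derivative (laguerrePoly ν (j + 1)) =
      C ((j : ℝ) + 1) * laguerrePoly ν (j + 1) - C ((j : ℝ) + 1 + ν) * laguerrePoly ν j := by
  have key (k : ℕ) : (k - ((j : ℝ) + 1)) * (laguerrePoly ν (j + 1)).coeff k =
      - ((j : ℝ) + 1 + ν) * (laguerrePoly ν j).coeff k := by
    have h1 := gamma_natCast_succ_add hν j
    rw [show ν + ((j + 1 : ℕ) : ℝ) + 1 = ((j + 1 : ℕ) : ℝ) + ν + 1 by ring,
      show ν + (j : ℝ) + 1 = (j : ℝ) + ν + 1 by ring] at h1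
    rw [coeff_laguerrePoly, coeff_laguerrePoly, h1, invFactorialSub_eq_succ_left j k]
    ring
  ext k
  rcases k with _ | k
  · have := key 0
    simp at this ⊢
    linarith
  · have := key (k + 1)
    simp only [coeff_sub, coeff_X_mul, coeff_C_mul, coeff_derivative]
    push_cast at this ⊢
    linear_combination this

open Polynomial in
theorem laguerrePoly_three_term {ν : ℝ} (hν : -1 < ν) (j : ℕ) :
    C ((j : ℝ) + 2) * laguerrePoly ν (j + 1 + 1) =
      (C (2 * (j : ℝ) + 3 + ν) - X) * laguerrePoly ν (j + 1) -
        C ((j : ℝ) + 1 + ν) * laguerrePoly ν j := by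
  have hg (j : ℕ) : Real.Gamma (((j + 1 : ℕ) : ℝ) + ν + 1) =
      (ν + j + 1) * Real.Gamma ((j : ℝ) + ν + 1) := by
    have h := gamma_natCast_succ_add hν j
    rwa [show ν + ((j + 1 : ℕ) : ℝ) + 1 = ((j + 1 : ℕ) : ℝ) + ν + 1 by ring,
      show Real.Gamma (ν + (j : ℝ) + 1) = Real.Gamma ((j : ℝ) + ν + 1) by rw [add_comm ν]] at h
  ext k
  rw [sub_mul]
  rcases k with _ | k
  · simp only [coeff_sub, mul_coeff_zero, coeff_X_zero, zero_mul, sub_zero,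
      coeff_C_zero, coeff_laguerrePoly, hg (j + 1), hg j, invFactorialSub_eq_succ_left j,
      invFactorialSub_eq_succ_left (j + 1)]
    push_cast
    ring
  · have h1 := gamma_natCast_add_ne_zero hν k
    have h2 : ν + k + 1 ≠ 0 := by have : (0 : ℝ) ≤ k := k.cast_nonneg; linarith
    have h3 : (k.factorial : ℝ) ≠ 0 := by positivity
    have h4 : (k : ℝ) + 1 ≠ 0 := by positivity
    simp only [coeff_sub, coeff_C_mul, coeff_X_mul, coeff_laguerrePoly, hg (j + 1), hg j,
      invFactorialSub_eq_succ_left j (k + 1), ← invFactorialSub_succ_succ (j + 1) k,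
      invFactorialSub_eq_succ_left (j + 1) (k + 1), gamma_natCast_succ_add hν k,
      Nat.factorial_succ]
    push_cast
    field_simp
    ring

open Polynomial in
theorem deriv_sum_mul_aeval_div (τ : ℂ) (N : ℕ) (q : ℕ → ℂ) (p : ℕ → ℝ[X]) :
    deriv (fun z : ℂ => ∑ j ∈ Finset.range N, q j * aeval (z / τ) (p j)) =
      fun z => ∑ j ∈ Finset.range N, q j / τ * aeval (z / τ) (derivative (p j)) := by
  ext z
  refine HasDerivAt.deriv (HasDerivAt.fun_sum fun j _ => ?_)
  have h := ((p j).hasDerivAt_aeval (z / τ)).comp z ((hasDerivAt_id z).div_const τ)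
  exact (h.const_mul (q j)).congr_deriv (by ring)

theorem christoffelDarboux_increment {τ x y ν n m c a₀ a₁ a₂ b₀ b₁ b₂ d₁ d₂ : ℂ}
    (hτ0 : τ ≠ 0) (hτ1 : 1 - τ ^ 2 ≠ 0)
    (hD : x * d₂ + (ν + 1) * d₁ = x * d₁ - (n + 1) * a₁)
    (hX : x * d₁ = (n + 1) * a₁ - m * a₀)
    (hx : (n + 2) * a₂ = (2 * n + 3 + ν - x) * a₁ - m * a₀)
    (hy : (n + 2) * b₂ = (2 * n + 3 + ν - y) * b₁ - m * b₀) :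
    (1 - τ ^ 2) * (τ * x) * (c * b₁ / τ / τ * d₂)
        + ((1 - τ ^ 2) * (ν + 1) + 2 * τ * (τ * x)) * (c * b₁ / τ * d₁)
        + ((τ ^ 2 * (τ * x) - τ * y) / (1 - τ ^ 2) + (ν + 1) * τ) * (c * b₁ * a₁)
      = (n + 2) * c * τ / (1 - τ ^ 2) * (a₁ * b₂ - τ ^ 2 * a₂ * b₁)
        - c * m / (τ * (1 - τ ^ 2)) * (a₀ * b₁ - τ ^ 2 * a₁ * b₀) := by
  field_simp
  linear_combination c * ((1 - τ ^ 2) ^ 2 * b₁ * hD +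
    (1 - τ ^ 2) * (1 + τ ^ 2) * b₁ * hX - τ ^ 2 * a₁ * hy + τ ^ 4 * b₁ * hx)

theorem laguerre_zero {ν : ℝ} (hν : -1 < ν) (z : ℂ) : laguerre ν 0 z = 1 := by
  have := gamma_natCast_add_ne_zero hν 0
  simp only [Nat.cast_zero, add_zero] at this
  simp [laguerre, this]

theorem laguerre_one {ν : ℝ} (hν : -1 < ν) (z : ℂ) : laguerre ν 1 z = ν + 1 - z := by
  have h0 := gamma_natCast_add_ne_zero hν 0
  have h1 := gamma_natCast_succ_add hν 0
  have h2 := gamma_natCast_add_ne_zero hν 1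
  simp only [Nat.cast_zero, add_zero, zero_add, Nat.cast_one] at h0 h1 h2
  have h3 : Real.Gamma (ν + 1 + 1) / Real.Gamma (ν + 1) = ν + 1 := by
    rw [h1]; field_simp
  simp only [laguerre, Finset.sum_range_succ, Finset.sum_range_zero]
  simp [add_comm (1 : ℝ) ν, h2]
  rw [← Complex.ofReal_div, h3]
  push_cast
  ring

/-- Generalised Christoffel–Darboux differential equation for the complex
non-Hermitian Wishart kernel (Theorem 1.1 (i)). -/
theorem stmt_0 (τ ν : ℝ) (hτ : τ ∈ Set.Ioo (0 : ℝ) 1) (hν : -1 < ν)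
    (N : ℕ) (hN : 1 ≤ N) (z w : ℂ) :
    (1 - (τ : ℂ) ^ 2) * z * deriv (deriv (fun z' => mathcalK τ ν N z' w)) z
      + ((1 - (τ : ℂ) ^ 2) * ((ν : ℂ) + 1) + 2 * (τ : ℂ) * z) *
          deriv (fun z' => mathcalK τ ν N z' w) z
      + (((τ : ℂ) ^ 2 * z - w) / (1 - (τ : ℂ) ^ 2) + ((ν : ℂ) + 1) * (τ : ℂ)) *
          mathcalK τ ν N z w
    = (((N.factorial : ℝ) * τ ^ (2 * N - 1) /
          (Real.Gamma ((N : ℝ) + ν) * (1 - τ ^ 2)) : ℝ) : ℂ) *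
        (laguerre ν (N - 1) (z / (τ : ℂ)) * laguerre ν N (w / (τ : ℂ))
          - (τ : ℂ) ^ 2 * laguerre ν N (z / (τ : ℂ)) * laguerre ν (N - 1) (w / (τ : ℂ))) := by
  obtain ⟨n, rfl⟩ : ∃ n, N = n + 1 := ⟨N - 1, by omega⟩
  clear hN
  have hτ0 : (τ : ℂ) ≠ 0 := by exact_mod_cast hτ.1.ne'
  have hτ1 : 1 - (τ : ℂ) ^ 2 ≠ 0 := by
    have h : 1 - τ ^ 2 ≠ 0 := by nlinarith [hτ.1, hτ.2]
    exact_mod_cast h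
  have hK (N : ℕ) : (fun z' => mathcalK τ ν N z' w) = fun z' => ∑ j ∈ Finset.range N,
      (((j.factorial : ℝ) * τ ^ (2 * j) / Real.Gamma ((j : ℝ) + ν + 1) : ℝ) : ℂ) *
        laguerre ν j (w / τ) * Polynomial.aeval (z' / (τ : ℂ)) (laguerrePoly ν j) := by
    ext z'
    refine Finset.sum_congr rfl fun j _ => ?_
    rw [laguerre_eq_aeval ν j (z' / τ)]
    ring
  have hKz := congrFun (hK (n + 1)) z
  beta_reduce at hKz
  rw [hK, deriv_sum_mul_aeval_div, deriv_sum_mul_aeval_div, hKz]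
  beta_reduce
  clear hK hKz
  induction n with
  | zero =>
    have h0 := laguerre_eq_aeval ν 0 (z / τ)
    have hP : Polynomial.derivative (laguerrePoly ν 0) = 0 := by simp [laguerrePoly]
    have hΓ := gamma_natCast_add_ne_zero hν 0
    simp only [Nat.cast_zero, add_zero] at hΓ
    have hΓ' : (Real.Gamma (ν + 1) : ℂ) ≠ 0 := by exact_mod_cast hΓ
    simp [← h0, hP, laguerre_zero hν, laguerre_one hν, add_comm (1 : ℝ) ν]
    field_simp
    ring
  | succ n ih =>
    simp only [Finset.sum_range_succ _ (n + 1)]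
    have hD := congrArg (Polynomial.aeval (z / (τ : ℂ))) (laguerrePoly_differential_eq hν (n + 1))
    have hX := congrArg (Polynomial.aeval (z / (τ : ℂ)))
      (X_mul_derivative_laguerrePoly_succ hν n)
    have hz := congrArg (Polynomial.aeval (z / (τ : ℂ))) (laguerrePoly_three_term hν n)
    have hw := congrArg (Polynomial.aeval (w / (τ : ℂ))) (laguerrePoly_three_term hν n)
    have hΓ := gamma_natCast_add_ne_zero hν n
    have hΓs := gamma_natCast_succ_add hν n
    simp only [map_add, map_sub, map_mul, map_one, map_ofNat, Polynomial.aeval_X,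
      Polynomial.aeval_C, Complex.coe_algebraMap, Complex.ofReal_natCast,
      ← laguerre_eq_aeval, Nat.cast_add, Nat.cast_one] at hD hX hz hw
    have hinc := christoffelDarboux_increment (c := (((n + 1).factorial : ℝ) *
      τ ^ (2 * (n + 1)) / Real.Gamma (((n + 1 : ℕ) : ℝ) + ν + 1) : ℝ)) hτ0 hτ1 hD hX hz hw
    rw [mul_div_cancel₀ _ hτ0, mul_div_cancel₀ _ hτ0] at hinc
    simp only [← laguerre_eq_aeval, Nat.add_sub_cancel] at ih hinc ⊢
    have hcoeff : ((((n + 1 + 1).factorial : ℝ) * τ ^ (2 * (n + 1 + 1) - 1) /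
          (Real.Gamma (((n + 1 + 1 : ℕ) : ℝ) + ν) * (1 - τ ^ 2)) : ℝ) : ℂ) =
        (n + 2) * (((n + 1).factorial : ℝ) * τ ^ (2 * (n + 1)) /
          Real.Gamma (((n + 1 : ℕ) : ℝ) + ν + 1) : ℝ) * τ / (1 - τ ^ 2) := by
      rw [show 2 * (n + 1 + 1) - 1 = 2 * (n + 1) + 1 by omega, Nat.factorial_succ,
        show ((n + 1 + 1 : ℕ) : ℝ) + ν = ((n + 1 : ℕ) : ℝ) + ν + 1 by push_cast; ring]
      push_cast
      simp only [div_eq_mul_inv, mul_inv]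
      ring
    have hcoeff' : ((((n + 1).factorial : ℝ) * τ ^ (2 * (n + 1) - 1) /
          (Real.Gamma (((n + 1 : ℕ) : ℝ) + ν) * (1 - τ ^ 2)) : ℝ) : ℂ) =
        (((n + 1).factorial : ℝ) * τ ^ (2 * (n + 1)) /
          Real.Gamma (((n + 1 : ℕ) : ℝ) + ν + 1) : ℝ) * (n + 1 + ν) / (τ * (1 - τ ^ 2)) := by
      rw [show 2 * (n + 1) - 1 = 2 * n + 1 by omega,
        show ((n + 1 : ℕ) : ℝ) + ν + 1 = ν + ((n + 1 : ℕ) : ℝ) + 1 by ring, hΓs,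
        show ((n + 1 : ℕ) : ℝ) + ν = ν + (n : ℝ) + 1 by push_cast; ring]
      have hΓ' : (Real.Gamma (ν + (n : ℝ) + 1) : ℂ) ≠ 0 := by exact_mod_cast hΓ
      have hν' : (ν : ℂ) + n + 1 ≠ 0 := by
        have : ν + n + 1 ≠ 0 := by have : (0 : ℝ) ≤ n := n.cast_nonneg; linarith
        exact_mod_cast this
      push_cast
      field_simp
      ring
    rw [hcoeff'] at ih
    rw [hcoeff]
    linear_combination ih + hinc
end

section
/- Let τ ∈ (0,1), ν > -1/2 and N ≥ 1 be an integer. Define G_N(z,w) := −(√π/2^{2ν+1})·∑_{k=0}^{N-1}∑_{j=0}^{k} ((2k)!!·τ^{2k+1}/(2^k·Γ(k+ν+3/2)))·((2j-1)!!·τ^{2j}/(2^j·Γ(j+ν+1)))·L_{2k+1}^{(2ν)}(z/τ)·L_{2j}^{(2ν)}(w/τ), and κ_N(z,w) := G_N(z,w) − G_N(w,z). Also define 𝒦_{2N}^{(2ν)}(z,w) := ∑_{j=0}^{2N-1} (j!·τ^{2j}/Γ(j+2ν+1))·L_j^{(2ν)}(z/τ)·L_j^{(2ν)}(w/τ). Then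 for all z,w ∈ ℂ: (1-τ²)·z·∂_z²κ_N(z,w) + ((2ν+1)(1-τ²) + 2τz)·∂_zκ_N(z,w) + (τ(2ν+1) − z)·κ_N(z,w) = 𝒦_{2N}^{(2ν)}(z,w) − (√π·N!·τ^{2N}/(2^{2ν}·Γ(N+ν+1/2)))·L_{2N}^{(2ν)}(z/τ)·∑_{j=0}^{N-1} ((2j-1)!!·τ^{2j}/(2^j·Γ(j+ν+1)))·L_{2j}^{(2ν)}(w/τ). -/
open MeasureTheory

/-- `G_N(z,w)` of the symplectic pre-kernel (unscaled variables). -/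
noncomputable def GN (τ ν : ℝ) (N : ℕ) (z w : ℂ) : ℂ :=
  -((Real.sqrt Real.pi / (2 : ℝ) ^ (2 * ν + 1) : ℝ) : ℂ) *
    ∑ k ∈ Finset.range N, ∑ j ∈ Finset.range (k + 1),
      ((((2 : ℝ) ^ k * (k.factorial : ℝ)) * τ ^ (2 * k + 1) /
          ((2 : ℝ) ^ k * Real.Gamma ((k : ℝ) + ν + 3 / 2)) : ℝ) : ℂ) *
        (((((2 * j).factorial : ℝ) / ((2 : ℝ) ^ j * (j.factorial : ℝ))) * τ ^ (2 * j) /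
            ((2 : ℝ) ^ j * Real.Gamma ((j : ℝ) + ν + 1)) : ℝ) : ℂ) *
        laguerre (2 * ν) (2 * k + 1) (z / (τ : ℂ)) *
        laguerre (2 * ν) (2 * j) (w / (τ : ℂ))

/-- The symplectic pre-kernel `κ_N(z,w) = G_N(z,w) - G_N(w,z)`. -/
noncomputable def kappaN (τ ν : ℝ) (N : ℕ) (z w : ℂ) : ℂ :=
  GN τ ν N z w - GN τ ν N w z

/-- The coefficient of `x ^ k` in `L_j^{(α)}(x)`. -/
noncomputable def laguerreCoeff (α : ℝ) (j k : ℕ) : ℝ :=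
  (-1) ^ k * (j.choose k : ℝ) * Real.Gamma (j + α + 1) /
    ((j.factorial : ℝ) * Real.Gamma (α + k + 1))

theorem laguerreCoeff_eq_zero (α : ℝ) {j k : ℕ} (h : j < k) : laguerreCoeff α j k = 0 := by
  simp [laguerreCoeff, Nat.choose_eq_zero_of_lt h]

theorem laguerre_eq_sum (α : ℝ) (j : ℕ) (z : ℂ) :
    laguerre α j z = ∑ k ∈ Finset.range (j + 1), (laguerreCoeff α j k : ℂ) * z ^ k := by
  refine Finset.sum_congr rfl fun k hk => ?_
  have hkj : k ≤ j := Nat.lt_succ_iff.mp (Finset.mem_range.mp hk)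
  have hfac : ((j.choose k : ℝ) * k.factorial * (j - k).factorial) = j.factorial := by
    exact_mod_cast Nat.choose_mul_factorial_mul_factorial hkj
  have hk0 : (k.factorial : ℝ) ≠ 0 := by positivity
  have hjk0 : ((j - k).factorial : ℝ) ≠ 0 := by positivity
  have hc0 : (j.choose k : ℝ) ≠ 0 := by exact_mod_cast (Nat.choose_pos hkj).ne'
  have hcoeff : laguerreCoeff α j k = Real.Gamma (j + α + 1) /
      (((j - k).factorial : ℝ) * Real.Gamma (α + k + 1)) * (-1) ^ k / k.factorial := by
    rw [laguerreCoeff, ← hfac]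
    field_simp
  rw [hcoeff, neg_pow z]
  push_cast
  ring

theorem Gamma_natCast_add_ne_zero {α : ℝ} (hα : -1 < α) (n : ℕ) :
    Real.Gamma (α + n + 1) ≠ 0 :=
  (Real.Gamma_pos_of_pos (by have : (0 : ℝ) ≤ n := n.cast_nonneg; linarith)).ne'

theorem Gamma_natCast_succ_add {α : ℝ} (hα : -1 < α) (n : ℕ) :
    Real.Gamma (α + (n + 1 : ℕ) + 1) = (α + n + 1) * Real.Gamma (α + n + 1) := by
  rw [← Real.Gamma_add_one (by have : (0 : ℝ) ≤ n := n.cast_nonneg; linarith)]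
  push_cast
  ring_nf

theorem natCast_succ_mul_choose (j k : ℕ) :
    ((k : ℝ) + 1) * (j.choose (k + 1) : ℝ) = (j - k) * (j.choose k : ℝ) := by
  rcases le_or_gt k j with h | h
  · have := Nat.choose_succ_right_eq j k
    rw [← Nat.cast_sub h]
    rw [mul_comm, mul_comm ((j - k : ℕ) : ℝ)]
    exact_mod_cast this
  · simp [Nat.choose_eq_zero_of_lt h, Nat.choose_eq_zero_of_lt (h.trans (Nat.lt_succ_self k))]

theorem laguerreCoeff_lower {α : ℝ} (hα : -1 < α) (j n : ℕ) :
    ((n : ℝ) + 1) * (n + 1 + α) * laguerreCoeff α (j + 1) (n + 1) =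
      -((j : ℝ) + 1 + α) * laguerreCoeff α j n := by
  have h1 := Gamma_natCast_add_ne_zero hα n
  have hj := Gamma_natCast_add_ne_zero hα j
  have h2 : α + n + 1 ≠ 0 := by have : (0 : ℝ) ≤ n := n.cast_nonneg; linarith
  have h3 : (j.factorial : ℝ) ≠ 0 := by positivity
  have h4 : ((n : ℝ) + 1) * ((j + 1).choose (n + 1) : ℝ) = (j + 1) * (j.choose n : ℝ) := by
    have := Nat.add_one_mul_choose_eq j n
    rw [mul_comm ((n : ℝ) + 1)]
    exact_mod_cast this.symm
  have h5 : (j : ℝ) + 1 ≠ 0 := by positivity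
  simp only [laguerreCoeff, add_comm ((_ : ℕ) : ℝ) α, Gamma_natCast_succ_add hα,
    Nat.factorial_succ, Nat.cast_mul, pow_succ]
  push_cast
  field_simp
  linear_combination (-(α + n + 1) * (α + j + 1)) * h4

theorem laguerreCoeff_raise_zero {α : ℝ} (hα : -1 < α) (j : ℕ) :
    -(1 + α) * laguerreCoeff α j 1 + (α + 1) * laguerreCoeff α j 0 =
      (j + 1) * laguerreCoeff α (j + 1) 0 := by
  have h1 := Gamma_natCast_add_ne_zero hα 0
  have h2 : α + 1 ≠ 0 := by linarith
  have h3 : (j.factorial : ℝ) ≠ 0 := by positivity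
  have h5 : (j : ℝ) + 1 ≠ 0 := by positivity
  simp only [Nat.cast_zero, add_zero] at h1
  simp only [laguerreCoeff, add_comm ((_ : ℕ) : ℝ) α, Gamma_natCast_succ_add hα,
    Nat.factorial_succ, Nat.cast_mul, Nat.cast_zero, add_zero, Nat.choose_zero_right,
    Nat.choose_one_right]
  push_cast
  field_simp
  ring

theorem laguerreCoeff_raise_succ {α : ℝ} (hα : -1 < α) (j n : ℕ) :
    -((n : ℝ) + 2) * (n + 2 + α) * laguerreCoeff α j (n + 2)
        + (2 * (n + 1) + α + 1) * laguerreCoeff α j (n + 1) - laguerreCoeff α j n =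
      (j + 1) * laguerreCoeff α (j + 1) (n + 1) := by
  have h1 := Gamma_natCast_add_ne_zero hα n
  have hj := Gamma_natCast_add_ne_zero hα j
  have h2 : α + n + 1 ≠ 0 := by have : (0 : ℝ) ≤ n := n.cast_nonneg; linarith
  have h2' : α + (n + 1) + 1 ≠ 0 := by have : (0 : ℝ) ≤ n := n.cast_nonneg; linarith
  have h3 : (j.factorial : ℝ) ≠ 0 := by positivity
  have h5 : (j : ℝ) + 1 ≠ 0 := by positivity
  have e1 := natCast_succ_mul_choose j n
  have e2 := natCast_succ_mul_choose j (n + 1)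
  simp only [laguerreCoeff, add_comm ((_ : ℕ) : ℝ) α, Gamma_natCast_succ_add hα,
    Nat.factorial_succ, Nat.cast_mul, pow_succ, Nat.choose_succ_succ' j n]
  push_cast at e2 ⊢
  field_simp
  linear_combination (-(α + n + 2)) * e2 - (α + n + 2) * e1

open Polynomial

/-- The polynomial `z ↦ L_j^{(α)}(z / τ)`. -/
noncomputable def scaledLaguerre (τ α : ℝ) (j : ℕ) : ℂ[X] :=
  ∑ k ∈ Finset.range (j + 1), monomial k ((laguerreCoeff α j k / τ ^ k : ℝ) : ℂ)

theorem coeff_scaledLaguerre (τ α : ℝ) (j n : ℕ) :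
    (scaledLaguerre τ α j).coeff n = ((laguerreCoeff α j n / τ ^ n : ℝ) : ℂ) := by
  simp only [scaledLaguerre, finsetSum_coeff, coeff_monomial, Finset.sum_ite_eq',
    Finset.mem_range]
  split_ifs with h
  · rfl
  · simp [laguerreCoeff_eq_zero α (show j < n by omega)]

theorem eval_scaledLaguerre (τ α : ℝ) (j : ℕ) (z : ℂ) :
    (scaledLaguerre τ α j).eval z = laguerre α j (z / τ) := by
  rw [laguerre_eq_sum, scaledLaguerre, eval_finsetSum]
  refine Finset.sum_congr rfl fun k _ => ?_
  rw [eval_monomial, div_pow]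
  push_cast
  ring

/-- The second-order operator `(1-τ²) z ∂² + ((α+1)(1-τ²) + 2τz) ∂ + (τ(α+1) - z)`
acting on polynomials. -/
noncomputable def wishartOp (τ α : ℂ) : ℂ[X] →ₗ[ℂ] ℂ[X] :=
  (1 - τ ^ 2) • (LinearMap.mulLeft ℂ X ∘ₗ derivative ∘ₗ derivative)
    + ((α + 1) * (1 - τ ^ 2)) • derivative + (2 * τ) • (LinearMap.mulLeft ℂ X ∘ₗ derivative)
    + (τ * (α + 1)) • LinearMap.id - LinearMap.mulLeft ℂ X

theorem wishartOp_apply (τ α : ℂ) (p : ℂ[X]) :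
    wishartOp τ α p = (1 - τ ^ 2) • (X * derivative (derivative p))
      + ((α + 1) * (1 - τ ^ 2)) • derivative p + (2 * τ) • (X * derivative p)
      + (τ * (α + 1)) • p - X * p := by
  simp [wishartOp]

theorem eval_wishartOp (τ α : ℂ) (p : ℂ[X]) (z : ℂ) :
    (wishartOp τ α p).eval z = (1 - τ ^ 2) * z * deriv (deriv fun x => p.eval x) z
      + ((α + 1) * (1 - τ ^ 2) + 2 * τ * z) * deriv (fun x => p.eval x) z
      + (τ * (α + 1) - z) * p.eval z := by
  have h : (deriv fun x => p.eval x) = fun x => (derivative p).eval x := by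
    ext x; exact p.deriv
  rw [h, Polynomial.deriv, wishartOp_apply]
  simp only [eval_add, eval_sub, eval_smul, eval_mul, eval_X, smul_eq_mul]
  ring

theorem wishartOp_scaledLaguerre_coeff {τ α : ℝ} (hτ : τ ≠ 0) (hα : -1 < α) (j n : ℕ) :
    (wishartOp τ α (scaledLaguerre τ α j)).coeff n =
      ((τ * (j + 1) * (laguerreCoeff α (j + 1) n / τ ^ n)
        + (n + 1) * (n + 1 + α) * laguerreCoeff α j (n + 1) / τ ^ (n + 1) : ℝ) : ℂ) := by
  have hτ' : (τ : ℂ) ≠ 0 := by exact_mod_cast hτ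
  rw [wishartOp_apply]
  cases n with
  | zero =>
    have h := congrArg (fun x : ℝ => (x : ℂ)) (laguerreCoeff_raise_zero hα j)
    simp only [coeff_add, coeff_sub, coeff_smul, coeff_X_mul_zero, coeff_derivative,
      coeff_scaledLaguerre, smul_eq_mul]
    push_cast at h ⊢
    simp only [zero_add, pow_zero, pow_one, div_one]
    field_simp
    linear_combination τ ^ 2 * h
  | succ n =>
    have h := congrArg (fun x : ℝ => (x : ℂ)) (laguerreCoeff_raise_succ hα j n)
    simp only [coeff_add, coeff_sub, coeff_smul, coeff_X_mul, coeff_derivative,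
      coeff_scaledLaguerre, smul_eq_mul]
    push_cast at h ⊢
    simp only [pow_succ]
    field_simp
    linear_combination τ ^ 2 * h

theorem wishartOp_scaledLaguerre_zero {τ α : ℝ} (hτ : τ ≠ 0) (hα : -1 < α) :
    wishartOp τ α (scaledLaguerre τ α 0) = (τ : ℂ) • scaledLaguerre τ α 1 := by
  ext n
  rw [wishartOp_scaledLaguerre_coeff hτ hα, coeff_smul, coeff_scaledLaguerre,
    laguerreCoeff_eq_zero α n.succ_pos]
  simp

theorem wishartOp_scaledLaguerre_succ {τ α : ℝ} (hτ : τ ≠ 0) (hα : -1 < α) (j : ℕ) :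
    wishartOp τ α (scaledLaguerre τ α (j + 1)) =
      (τ * (j + 2) : ℂ) • scaledLaguerre τ α (j + 2)
        - ((j + 1 + α) / τ : ℂ) • scaledLaguerre τ α j := by
  ext n
  rw [wishartOp_scaledLaguerre_coeff hτ hα, laguerreCoeff_lower hα, coeff_sub, coeff_smul,
    coeff_smul, coeff_scaledLaguerre, coeff_scaledLaguerre, pow_succ]
  push_cast
  simp only [smul_eq_mul]
  ring

/-- The coefficient of the odd-index Laguerre polynomial `L_{2k+1}^{(2ν)}` in `G_N`. -/
noncomputable def oddCoeff (τ ν : ℝ) (k : ℕ) : ℝ :=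
  ((2 : ℝ) ^ k * (k.factorial : ℝ)) * τ ^ (2 * k + 1) /
    ((2 : ℝ) ^ k * Real.Gamma ((k : ℝ) + ν + 3 / 2))

/-- The coefficient of the even-index Laguerre polynomial `L_{2j}^{(2ν)}` in `G_N`. -/
noncomputable def evenCoeff (τ ν : ℝ) (j : ℕ) : ℝ :=
  (((2 * j).factorial : ℝ) / ((2 : ℝ) ^ j * (j.factorial : ℝ))) * τ ^ (2 * j) /
    ((2 : ℝ) ^ j * Real.Gamma ((j : ℝ) + ν + 1))

/-- The coefficient of `L_{2k}^{(2ν)}` in the image of the odd part under `wishartOp`. -/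
noncomputable def oddImageCoeff (τ ν : ℝ) (k : ℕ) : ℝ :=
  2 * (k.factorial : ℝ) * τ ^ (2 * k) / Real.Gamma ((k : ℝ) + ν + 1 / 2)

theorem oddCoeff_mul_raise {τ ν : ℝ} (k : ℕ) :
    oddCoeff τ ν k * (τ * (2 * k + 2)) = oddImageCoeff τ ν (k + 1) := by
  have h : ((k + 1 : ℕ) : ℝ) + ν + 1 / 2 = k + ν + 3 / 2 := by push_cast; ring
  rw [oddCoeff, oddImageCoeff, h, Nat.factorial_succ, mul_assoc ((2 : ℝ) ^ k),
    mul_div_mul_left _ _ (by positivity)]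
  push_cast
  ring

theorem oddCoeff_mul_lower {τ ν : ℝ} (hτ : τ ≠ 0) (hν : -(1 / 2 : ℝ) < ν) (k : ℕ) :
    oddCoeff τ ν k * ((2 * k + 1 + 2 * ν) / τ) = oddImageCoeff τ ν k := by
  have hpos : 0 < (k : ℝ) + ν + 1 / 2 := by
    have : (0 : ℝ) ≤ k := k.cast_nonneg
    linarith
  have h : Real.Gamma ((k : ℝ) + ν + 3 / 2) =
      (k + ν + 1 / 2) * Real.Gamma ((k : ℝ) + ν + 1 / 2) := by
    rw [← Real.Gamma_add_one hpos.ne']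
    ring_nf
  have hG := (Real.Gamma_pos_of_pos hpos).ne'
  rw [oddCoeff, oddImageCoeff, h, mul_assoc ((2 : ℝ) ^ k), mul_div_mul_left _ _ (by positivity),
    pow_succ, show 2 * (k : ℝ) + 1 + 2 * ν = 2 * (k + ν + 1 / 2) by ring]
  generalize (k : ℝ) + ν + 1 / 2 = s at *
  have hs := hpos.ne'
  field_simp

theorem evenCoeff_succ_mul_lower {τ ν : ℝ} (hτ : τ ≠ 0) (hν : -(1 / 2 : ℝ) < ν) (j : ℕ) :
    evenCoeff τ ν (j + 1) * ((2 * j + 2 + 2 * ν) / τ) =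
      evenCoeff τ ν j * (τ * (2 * j + 1)) := by
  have hpos : 0 < (j : ℝ) + ν + 1 := by
    have : (0 : ℝ) ≤ j := j.cast_nonneg
    linarith
  have h : Real.Gamma (((j + 1 : ℕ) : ℝ) + ν + 1) =
      (j + ν + 1) * Real.Gamma ((j : ℝ) + ν + 1) := by
    rw [← Real.Gamma_add_one hpos.ne']
    push_cast
    ring_nf
  have hG := (Real.Gamma_pos_of_pos hpos).ne'
  have hj : ((j.factorial : ℕ) : ℝ) ≠ 0 := by positivity
  rw [evenCoeff, evenCoeff, h, show 2 * (j + 1) = 2 * j + 1 + 1 by ring, Nat.factorial_succ,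
    Nat.factorial_succ, Nat.factorial_succ, pow_succ, pow_succ, pow_succ]
  push_cast
  field_simp
  ring

theorem oddCoeff_mul_evenCoeff_raise {τ ν : ℝ} (hν : -(1 / 2 : ℝ) < ν) (k : ℕ) :
    Real.sqrt Real.pi / (2 : ℝ) ^ (2 * ν + 1) *
        (oddCoeff τ ν k * (evenCoeff τ ν k * (τ * (2 * k + 1)))) =
      ((2 * k + 1).factorial : ℝ) * τ ^ (2 * (2 * k + 1)) /
        Real.Gamma ((2 * k + 1 : ℕ) + 2 * ν + 1) := by
  have hk0 : (0 : ℝ) ≤ k := k.cast_nonneg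
  have hG1 := (Real.Gamma_pos_of_pos (show 0 < (k : ℝ) + ν + 1 by linarith)).ne'
  have hG2 := (Real.Gamma_pos_of_pos (show 0 < (k : ℝ) + ν + 3 / 2 by linarith)).ne'
  have hG3 := (Real.Gamma_pos_of_pos
    (show 0 < ((2 * k + 1 : ℕ) : ℝ) + 2 * ν + 1 by push_cast; linarith)).ne'
  have hdup := Real.Gamma_mul_Gamma_add_half ((k : ℝ) + ν + 1)
  rw [show (k : ℝ) + ν + 1 + 1 / 2 = k + ν + 3 / 2 by ring,
    show 2 * ((k : ℝ) + ν + 1) = (2 * k + 1 : ℕ) + 2 * ν + 1 by push_cast; ring,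
    show 1 - (((2 * k + 1 : ℕ) : ℝ) + 2 * ν + 1) = -(2 * ν + 1 + (2 * k : ℕ)) by push_cast; ring,
    Real.rpow_neg (by norm_num), Real.rpow_add (by norm_num), Real.rpow_natCast] at hdup
  have hp : (2 : ℝ) ^ (2 * ν + 1) ≠ 0 := by positivity
  have hk : ((k.factorial : ℕ) : ℝ) ≠ 0 := by positivity
  rw [oddCoeff, evenCoeff, Nat.factorial_succ]
  generalize (2 : ℝ) ^ (2 * ν + 1) = p at *
  generalize Real.Gamma ((2 * k + 1 : ℕ) + 2 * ν + 1) = g at *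
  generalize Real.Gamma ((k : ℝ) + ν + 1) = g1 at *
  generalize Real.Gamma ((k : ℝ) + ν + 3 / 2) = g2 at *
  push_cast
  field_simp at hdup ⊢
  ring_nf at hdup ⊢
  linear_combination (-τ ^ 2 * τ ^ (k * 4)) * hdup

theorem oddImageCoeff_mul_evenCoeff {τ ν : ℝ} (hν : -(1 / 2 : ℝ) < ν) (k : ℕ) :
    Real.sqrt Real.pi / (2 : ℝ) ^ (2 * ν + 1) * (oddImageCoeff τ ν k * evenCoeff τ ν k) =
      ((2 * k).factorial : ℝ) * τ ^ (2 * (2 * k)) / Real.Gamma ((2 * k : ℕ) + 2 * ν + 1) := by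
  have hk0 : (0 : ℝ) ≤ k := k.cast_nonneg
  have hG1 := (Real.Gamma_pos_of_pos (show 0 < (k : ℝ) + ν + 1 by linarith)).ne'
  have hG2 := (Real.Gamma_pos_of_pos (show 0 < (k : ℝ) + ν + 1 / 2 by linarith)).ne'
  have hG3 := (Real.Gamma_pos_of_pos
    (show 0 < ((2 * k : ℕ) : ℝ) + 2 * ν + 1 by push_cast; linarith)).ne'
  have hdup := Real.Gamma_mul_Gamma_add_half ((k : ℝ) + ν + 1 / 2)
  rw [show (k : ℝ) + ν + 1 / 2 + 1 / 2 = k + ν + 1 by ring,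
    show 2 * ((k : ℝ) + ν + 1 / 2) = (2 * k : ℕ) + 2 * ν + 1 by push_cast; ring,
    show 1 - (((2 * k : ℕ) : ℝ) + 2 * ν + 1) = -(2 * ν + 1 + (2 * k : ℕ)) + 1 by push_cast; ring,
    Real.rpow_add_one (by norm_num), Real.rpow_neg (by norm_num), Real.rpow_add (by norm_num),
    Real.rpow_natCast] at hdup
  have hp : (2 : ℝ) ^ (2 * ν + 1) ≠ 0 := by positivity
  have hk : ((k.factorial : ℕ) : ℝ) ≠ 0 := by positivity
  rw [oddImageCoeff, evenCoeff]
  generalize (2 : ℝ) ^ (2 * ν + 1) = p at *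
  generalize Real.Gamma ((2 * k : ℕ) + 2 * ν + 1) = g at *
  generalize Real.Gamma ((k : ℝ) + ν + 1) = g1 at *
  generalize Real.Gamma ((k : ℝ) + ν + 1 / 2) = g2 at *
  field_simp at hdup ⊢
  ring_nf at hdup ⊢
  linear_combination (-τ ^ (k * 4)) * hdup

theorem wishartOp_odd {τ ν : ℝ} (hτ : τ ≠ 0) (hν : -(1 / 2 : ℝ) < ν) (k : ℕ) :
    (oddCoeff τ ν k : ℂ) •
        wishartOp τ (2 * ν : ℝ) (scaledLaguerre τ (2 * ν) (2 * k + 1)) =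
      (oddImageCoeff τ ν (k + 1) : ℂ) • scaledLaguerre τ (2 * ν) (2 * k + 2)
        - (oddImageCoeff τ ν k : ℂ) • scaledLaguerre τ (2 * ν) (2 * k) := by
  rw [wishartOp_scaledLaguerre_succ hτ (by linarith), smul_sub, smul_smul, smul_smul,
    ← oddCoeff_mul_raise, ← oddCoeff_mul_lower hτ hν]
  push_cast
  rfl

theorem wishartOp_even_sum {τ ν : ℝ} (hτ : τ ≠ 0) (hν : -(1 / 2 : ℝ) < ν) (k : ℕ) :
    ∑ j ∈ Finset.range (k + 1), (evenCoeff τ ν j : ℂ) •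
        wishartOp τ (2 * ν : ℝ) (scaledLaguerre τ (2 * ν) (2 * j)) =
      (evenCoeff τ ν k * (τ * (2 * k + 1)) : ℂ) • scaledLaguerre τ (2 * ν) (2 * k + 1) := by
  induction k with
  | zero =>
    rw [zero_add, Finset.sum_range_one, mul_zero,
      wishartOp_scaledLaguerre_zero hτ (by linarith), smul_smul]
    simp
  | succ k ih =>
    have h := congrArg (fun x : ℝ => (x : ℂ)) (evenCoeff_succ_mul_lower hτ hν k)
    rw [Finset.sum_range_succ, ih, show 2 * (k + 1) = 2 * k + 1 + 1 by ring,
      wishartOp_scaledLaguerre_succ hτ (by linarith), smul_sub, smul_smul, smul_smul]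
    push_cast at h ⊢
    rw [← h]
    module

/-- The polynomial in the first variable of `kappaN`, before the overall constant. -/
noncomputable def kappaPoly (τ ν : ℝ) (N : ℕ) (w : ℂ) : ℂ[X] :=
  ∑ k ∈ Finset.range N,
    ((oddCoeff τ ν k * laguerre (2 * ν) (2 * k + 1) (w / τ) : ℂ) •
        ∑ j ∈ Finset.range (k + 1), (evenCoeff τ ν j : ℂ) • scaledLaguerre τ (2 * ν) (2 * j)
      - (∑ j ∈ Finset.range (k + 1), (evenCoeff τ ν j : ℂ) * laguerre (2 * ν) (2 * j) (w / τ)) •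
        (oddCoeff τ ν k : ℂ) • scaledLaguerre τ (2 * ν) (2 * k + 1))

theorem kappaN_eq_eval (τ ν : ℝ) (N : ℕ) (z w : ℂ) :
    kappaN τ ν N z w =
      (((Real.sqrt Real.pi / (2 : ℝ) ^ (2 * ν + 1) : ℝ) : ℂ) • kappaPoly τ ν N w).eval z := by
  rw [kappaN, GN, GN, kappaPoly, eval_smul, eval_finsetSum, smul_eq_mul, neg_mul, neg_mul,
    neg_sub_neg, ← mul_sub, ← Finset.sum_sub_distrib]
  congr 1
  refine Finset.sum_congr rfl fun k _ => ?_
  simp only [eval_sub, eval_smul, eval_finsetSum, eval_scaledLaguerre, smul_eq_mul,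
    Finset.mul_sum, Finset.sum_mul]
  refine congrArg₂ (· - ·) (Finset.sum_congr rfl fun j _ => ?_)
    (Finset.sum_congr rfl fun j _ => ?_)
  · rw [oddCoeff, evenCoeff]; ring
  · rw [oddCoeff, evenCoeff]; ring

theorem eval_wishartOp_kappaPoly {τ ν : ℝ} (hτ : τ ≠ 0) (hν : -(1 / 2 : ℝ) < ν) (N : ℕ)
    (z w : ℂ) :
    ((Real.sqrt Real.pi / (2 : ℝ) ^ (2 * ν + 1) : ℝ) : ℂ) *
        (wishartOp τ (2 * ν : ℝ) (kappaPoly τ ν N w)).eval z =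
      mathcalK τ (2 * ν) (2 * N) z w
        - ((Real.sqrt Real.pi / (2 : ℝ) ^ (2 * ν + 1) * oddImageCoeff τ ν N : ℝ) : ℂ) *
          laguerre (2 * ν) (2 * N) (z / τ) *
          ∑ j ∈ Finset.range N, (evenCoeff τ ν j : ℂ) * laguerre (2 * ν) (2 * j) (w / τ) := by
  induction N with
  | zero => simp [kappaPoly, mathcalK]
  | succ N ih =>
    have h1 := congrArg (fun x : ℝ => (x : ℂ)) (oddCoeff_mul_evenCoeff_raise (τ := τ) hν N)
    have h2 := congrArg (fun x : ℝ => (x : ℂ)) (oddImageCoeff_mul_evenCoeff (τ := τ) hν N)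
    have hK : mathcalK τ (2 * ν) (2 * (N + 1)) z w = mathcalK τ (2 * ν) (2 * N) z w
        + ((((2 * N).factorial : ℝ) * τ ^ (2 * (2 * N)) /
              Real.Gamma ((2 * N : ℕ) + 2 * ν + 1) : ℝ) : ℂ) *
            laguerre (2 * ν) (2 * N) (z / τ) * laguerre (2 * ν) (2 * N) (w / τ)
        + ((((2 * N + 1).factorial : ℝ) * τ ^ (2 * (2 * N + 1)) /
              Real.Gamma ((2 * N + 1 : ℕ) + 2 * ν + 1) : ℝ) : ℂ) *
            laguerre (2 * ν) (2 * N + 1) (z / τ) * laguerre (2 * ν) (2 * N + 1) (w / τ) := by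
      rw [mathcalK, show 2 * (N + 1) = 2 * N + 1 + 1 by ring, Finset.sum_range_succ,
        Finset.sum_range_succ, mathcalK]
    have hstep : (wishartOp τ (2 * ν : ℝ) (kappaPoly τ ν (N + 1) w)).eval z =
        (wishartOp τ (2 * ν : ℝ) (kappaPoly τ ν N w)).eval z
        + oddCoeff τ ν N * laguerre (2 * ν) (2 * N + 1) (w / τ) *
            (evenCoeff τ ν N * (τ * (2 * N + 1)) * laguerre (2 * ν) (2 * N + 1) (z / τ))
        - (∑ j ∈ Finset.range (N + 1),
              (evenCoeff τ ν j : ℂ) * laguerre (2 * ν) (2 * j) (w / τ)) *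
            (oddImageCoeff τ ν (N + 1) * laguerre (2 * ν) (2 * N + 2) (z / τ)
              - oddImageCoeff τ ν N * laguerre (2 * ν) (2 * N) (z / τ)) := by
      rw [kappaPoly, Finset.sum_range_succ, ← kappaPoly]
      simp only [map_add, map_sub, map_smul, map_sum]
      rw [wishartOp_odd hτ hν, wishartOp_even_sum hτ hν]
      simp only [eval_add, eval_sub, eval_smul, eval_scaledLaguerre, smul_eq_mul]
      ring
    rw [hstep, hK, ← h1, ← h2, mul_sub, mul_add, ih, Finset.sum_range_succ,
      show 2 * (N + 1) = 2 * N + 2 by ring]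
    push_cast
    ring

/-- Generalised Christoffel–Darboux differential equation for the symplectic
non-Hermitian Wishart pre-kernel (Theorem 1.1 (ii)). -/
theorem stmt_1 (τ ν : ℝ) (hτ : τ ∈ Set.Ioo (0 : ℝ) 1) (hν : -(1 / 2 : ℝ) < ν)
    (N : ℕ) (hN : 1 ≤ N) (z w : ℂ) :
    (1 - (τ : ℂ) ^ 2) * z * deriv (deriv (fun z' => kappaN τ ν N z' w)) z
      + ((2 * (ν : ℂ) + 1) * (1 - (τ : ℂ) ^ 2) + 2 * (τ : ℂ) * z) *
          deriv (fun z' => kappaN τ ν N z' w) z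
      + ((τ : ℂ) * (2 * (ν : ℂ) + 1) - z) * kappaN τ ν N z w
    = mathcalK τ (2 * ν) (2 * N) z w
      - ((Real.sqrt Real.pi * (N.factorial : ℝ) * τ ^ (2 * N) /
            ((2 : ℝ) ^ (2 * ν) * Real.Gamma ((N : ℝ) + ν + 1 / 2)) : ℝ) : ℂ) *
          laguerre (2 * ν) (2 * N) (z / (τ : ℂ)) *
          ∑ j ∈ Finset.range N,
            (((((2 * j).factorial : ℝ) / ((2 : ℝ) ^ j * (j.factorial : ℝ))) * τ ^ (2 * j) /
                ((2 : ℝ) ^ j * Real.Gamma ((j : ℝ) + ν + 1)) : ℝ) : ℂ) *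
              laguerre (2 * ν) (2 * j) (w / (τ : ℂ)) := by
  have h := eval_wishartOp_kappaPoly hτ.1.ne' hν N z w
  have hC : Real.sqrt Real.pi / (2 : ℝ) ^ (2 * ν + 1) * oddImageCoeff τ ν N =
      Real.sqrt Real.pi * (N.factorial : ℝ) * τ ^ (2 * N) /
        ((2 : ℝ) ^ (2 * ν) * Real.Gamma ((N : ℝ) + ν + 1 / 2)) := by
    rw [oddImageCoeff, Real.rpow_add_one (by norm_num)]
    field_simp
  rw [hC, ← smul_eq_mul, ← eval_smul, ← map_smul, eval_wishartOp] at h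
  simp only [← kappaN_eq_eval] at h
  simp only [evenCoeff] at h
  rw [← h]
  push_cast
  ring
end

section
/- Let τ ∈ (0,1). For R > 0 and θ ∈ ℝ define Ω̃(R,θ) := (1/(1−τ²))·( (R² + τ² + 2Rτ·cos θ)/R − τ·(R + τ²/R)·cos θ − 2τ² ) − log R − (τ/R)·cos θ − 1. Then for all R ≥ τ and all θ ∈ ℝ one has Ω̃(R,θ) ≥ 0, and Ω̃(R,θ) = 0 if and only if R = 1. -/
open MeasureTheory

/-- The function `Ω̃(R,θ)` of Lemma 4.3 in polar coordinates. -/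
noncomputable def OmegaTilde (τ R θ : ℝ) : ℝ :=
  (1 / (1 - τ ^ 2)) *
      ((R ^ 2 + τ ^ 2 + 2 * R * τ * Real.cos θ) / R
        - τ * (R + τ ^ 2 / R) * Real.cos θ - 2 * τ ^ 2)
    - Real.log R - (τ / R) * Real.cos θ - 1

lemma OmegaTilde_one {τ : ℝ} (hτ : τ ^ 2 ≠ 1) (θ : ℝ) : OmegaTilde τ 1 θ = 0 := by
  have h : 1 - τ ^ 2 ≠ 0 := sub_ne_zero.mpr hτ.symm
  simp only [OmegaTilde, Real.log_one]
  field_simp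
  ring

lemma OmegaTilde_eq {τ R : ℝ} (hτ : τ ^ 2 ≠ 1) (hR : R ≠ 0) (θ : ℝ) :
    OmegaTilde τ R θ = (1 - τ) / (1 - τ ^ 2) * (R - τ / R - 1 + τ - (1 + τ) * Real.log R)
      + τ * (1 - Real.cos θ) * (R - 1) ^ 2 / ((1 - τ ^ 2) * R) := by
  have h : 1 - τ ^ 2 ≠ 0 := sub_ne_zero.mpr hτ.symm
  simp only [OmegaTilde]
  field_simp
  ring

lemma hasDerivAt_sub_div_sub_log (τ : ℝ) {x : ℝ} (hx : x ≠ 0) :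
    HasDerivAt (fun y : ℝ => y - τ / y - 1 + τ - (1 + τ) * Real.log y)
      ((x - 1) * (x - τ) / x ^ 2) x := by
  have h := (((((hasDerivAt_id x).sub ((hasDerivAt_inv hx).const_mul τ)).sub_const 1).add_const
    τ).sub ((Real.hasDerivAt_log hx).const_mul (1 + τ)))
  refine h.congr_deriv ?_
  field_simp
  ring

lemma sub_div_sub_log_pos {τ R : ℝ} (h0 : 0 < τ) (h1 : τ < 1) (hR : τ ≤ R) (hne : R ≠ 1) :
    0 < R - τ / R - 1 + τ - (1 + τ) * Real.log R := by
  set f : ℝ → ℝ := fun y => y - τ / y - 1 + τ - (1 + τ) * Real.log y with hf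
  have hf1 : f 1 = 0 := by simp [hf]
  have hd : ∀ x : ℝ, 0 < x → HasDerivAt f ((x - 1) * (x - τ) / x ^ 2) x :=
    fun x hx => hasDerivAt_sub_div_sub_log τ hx.ne'
  change 0 < f R
  rw [← hf1]
  rcases lt_or_gt_of_ne hne with hlt | hgt
  · have hanti : StrictAntiOn f (Set.Icc τ 1) := by
      refine strictAntiOn_of_deriv_neg (convex_Icc τ 1)
        (fun x hx => (hd x (h0.trans_le hx.1)).continuousAt.continuousWithinAt) ?_
      intro x hx
      rw [interior_Icc] at hx
      have hx0 : 0 < x := h0.trans hx.1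
      rw [(hd x hx0).deriv]
      exact div_neg_of_neg_of_pos
        (mul_neg_of_neg_of_pos (sub_neg.mpr hx.2) (sub_pos.mpr hx.1)) (by positivity)
    exact hanti ⟨hR, hlt.le⟩ ⟨h1.le, le_rfl⟩ hlt
  · have hmono : StrictMonoOn f (Set.Ici 1) := by
      refine strictMonoOn_of_deriv_pos (convex_Ici 1)
        (fun x hx => (hd x (one_pos.trans_le hx)).continuousAt.continuousWithinAt) ?_
      intro x hx
      rw [interior_Ici] at hx
      have hx1 : 1 < x := hx
      have hx0 : 0 < x := one_pos.trans hx1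
      rw [(hd x hx0).deriv]
      exact div_pos (mul_pos (sub_pos.mpr hx1) (sub_pos.mpr (h1.trans hx1))) (by positivity)
    exact hmono (Set.mem_Ici.mpr le_rfl) (Set.mem_Ici.mpr hgt.le) hgt

lemma OmegaTilde_pos {τ R : ℝ} (h0 : 0 < τ) (h1 : τ < 1) (hR : τ ≤ R) (hne : R ≠ 1) (θ : ℝ) :
    0 < OmegaTilde τ R θ := by
  have hτ : 0 < 1 - τ ^ 2 := by nlinarith
  have hR0 : 0 < R := h0.trans_le hR
  have hc : 0 ≤ 1 - Real.cos θ := sub_nonneg.mpr (Real.cos_le_one θ)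
  rw [OmegaTilde_eq (by linarith) hR0.ne']
  have hpos := mul_pos (div_pos (sub_pos.mpr h1) hτ) (sub_div_sub_log_pos h0 h1 hR hne)
  have hnonneg : 0 ≤ τ * (1 - Real.cos θ) * (R - 1) ^ 2 / ((1 - τ ^ 2) * R) := by positivity
  linarith

/-- Positivity of `Ω̃` off the unit circle (Lemma 4.3, polar-coordinate form). -/
theorem stmt_15 (τ : ℝ) (hτ : τ ∈ Set.Ioo (0 : ℝ) 1) :
    ∀ R θ : ℝ, τ ≤ R →
      0 ≤ OmegaTilde τ R θ ∧ (OmegaTilde τ R θ = 0 ↔ R = 1) := by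
  intro R θ hR
  obtain ⟨h0, h1⟩ := hτ
  rcases eq_or_ne R 1 with rfl | hne
  · have h := OmegaTilde_one (τ := τ) (by nlinarith) θ
    exact ⟨h.ge, fun _ => rfl, fun _ => h⟩
  · have h := OmegaTilde_pos h0 h1 hR hne θ
    exact ⟨h.le, fun h' => absurd h' h.ne', fun h' => absurd h' hne⟩
end
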